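/- Assume r > d. Then for every fixed i ≥ 1, as j → ∞, p_{i,j} = (2d/r)^i · i! / j^i + O(1/j^{i+1}); i.e., the function j ↦ p_{i,j} − (2d/r)^i · i!/j^i is O(1/j^{i+1}) as j → ∞. -/

import Mathlib

/-- `hitProbAux r d T (i, j) = ℙ_{i,j}[τ₀ ≤ T]`: the probability, for the discrete-time
Markov chain on `ℕ × ℕ` (jumping from a non-absorbed state `(i,j)` to `(i+1,j)` and `(i,j+1)`
with probability `r/(2(r+d))` each, and to `(i-1,j)`, `(i,j-1)` with probabilities
`d·i/((r+d)(i+j))` and `d·j/((r+d)(i+j))`, states with a zero coordinate being absorbing),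
started at `(i,j)`, that one of the axes is reached within `T` steps. -/
noncomputable def hitProbAux (r d : ℝ) : ℕ → ℕ × ℕ → ℝ
  | 0, p => if p.1 = 0 ∨ p.2 = 0 then 1 else 0
  | T + 1, p =>
      if p.1 = 0 ∨ p.2 = 0 then 1
      else
        r / (2 * (r + d)) * hitProbAux r d T (p.1 + 1, p.2)
          + r / (2 * (r + d)) * hitProbAux r d T (p.1, p.2 + 1)
          + d * p.1 / ((r + d) * ((p.1 : ℝ) + (p.2 : ℝ))) * hitProbAux r d T (p.1 - 1, p.2)
          + d * p.2 / ((r + d) * ((p.1 : ℝ) + (p.2 : ℝ))) * hitProbAux r d T (p.1, p.2 - 1)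

/-- `extinctionProb r d i j = p_{i,j} = ℙ_{i,j}[τ₀ < ∞]`, where
`τ₀ = inf {t : X_t = 0 or Y_t = 0}`: it is the supremum (monotone limit) over the time
horizon `T` of `ℙ_{i,j}[τ₀ ≤ T] = hitProbAux r d T (i, j)`. -/
noncomputable def extinctionProb (r d : ℝ) (i j : ℕ) : ℝ :=
  ⨆ T : ℕ, hitProbAux r d T (i, j)

open Asymptotics Filter

lemma aux_V (a b c : ℝ) (ha : 0 < a) (hb : 0 < b) (hab : 2 * a + b = 1) (hc : 0 < c) (n : ℕ) :
    ∃ N0 : ℕ, ∀ i j : ℕ, N0 ≤ i + j → n ≤ i → ∀ l μ : ℝ, 0 ≤ l → l ≤ 1 → 0 ≤ μ → μ ≤ 1 + a / 16 →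
      (a * ((1/2:ℝ)^i / 2) + a * (1/2:ℝ)^i) * l
        + (b * ((i:ℝ) / (i + j)) * (2 * (1/2:ℝ)^i) + b * ((j:ℝ) / (i + j)) * (1/2:ℝ)^i) * μ
        + (if i = n then a / 8 * (1/2:ℝ)^n else 0) ≤ (1/2:ℝ)^i + c / 2 / (i + j) := by
  have hlim : Tendsto (fun i : ℕ => (i:ℝ) * (1/2:ℝ)^i) atTop (nhds 0) :=
    tendsto_self_mul_const_pow_of_lt_one (by norm_num) (by norm_num)
  have hx1 : 0 < a / (4 * b) := by positivity
  obtain ⟨I0, hI0⟩ := eventually_atTop.1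
    (hlim.eventually (ge_mem_nhds (show (0:ℝ) < c / 4 * (a / (4 * b)) by positivity)))
  obtain ⟨N0, hN0⟩ := exists_nat_gt (((I0:ℝ) + n) / (a / (4 * b)))
  refine ⟨N0 + 1, fun i j hN hni l μ hl0 hl1 hm0 hm1 => ?_⟩
  have hNpos : (0:ℝ) < (i:ℝ) + j := by
    have : 0 < i + j := by omega
    exact_mod_cast this
  have hNR : (N0:ℝ) ≤ (i:ℝ) + j := by
    have : N0 ≤ i + j := by omega
    exact_mod_cast this
  set x : ℝ := (i:ℝ) / (i + j) with hx
  have hy : (j:ℝ) / (i + j) = 1 - x := by rw [hx]; field_simp; ring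
  have hx0 : 0 ≤ x := by positivity
  have hx1' : x ≤ 1 := by rw [hx, div_le_one hNpos]; have : (0:ℝ) ≤ j := by positivity
                          linarith
  rw [hy]
  set w : ℝ := (1/2:ℝ)^i with hw
  have hwpos : 0 < w := by positivity
  have ha1 : a ≤ 1 := by linarith
  have hb1 : b ≤ 1 := by linarith
  have h1 : (a * (w / 2) + a * w) * l ≤ (a * (w / 2) + a * w) :=
    mul_le_of_le_one_right (by positivity) hl1
  have h2 : (b * x * (2 * w) + b * (1 - x) * w) * μ ≤ (b * (1 + x) * w) * (1 + a / 16) := by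
    have : b * x * (2 * w) + b * (1 - x) * w = b * (1 + x) * w := by ring
    rw [this]
    exact mul_le_mul_of_nonneg_left hm1 (by positivity)
  have hbx : b * (1 + x) ≤ 2 := by nlinarith
  have h3 : b * (1 + x) * w * (1 + a / 16) ≤ b * (1 + x) * w + w * (a / 8) := by
    have : b * (1 + x) * w * (a / 16) ≤ 2 * w * (a / 16) := by gcongr
    nlinarith
  by_cases hc1 : b * x ≤ a / 4
  · have h4 : (if i = n then a / 8 * (1/2:ℝ)^n else 0) ≤ a / 8 * w := by
      split_ifs with h
      · rw [hw, h]
      · positivity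
    have h5 : b * x * w ≤ a / 4 * w := by gcongr
    have h6 : 0 < c / 2 / ((i:ℝ) + j) := by positivity
    nlinarith
  · push Not at hc1
    have hi : a / (4 * b) * ((i:ℝ) + j) < i := by
      rw [hx] at hc1
      have : a / 4 < b * i / (i + j) := by rw [mul_div_assoc]; exact hc1
      rw [lt_div_iff₀ hNpos] at this
      rw [div_mul_eq_mul_div, div_lt_iff₀ (by positivity)]
      linarith
    have hbig : (I0:ℝ) + n < i := by
      rw [div_lt_iff₀ hx1] at hN0
      nlinarith
    have hin : i ≠ n := by
      rintro rfl
      have : (0:ℝ) ≤ I0 := by positivity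
      linarith
    have hI : I0 ≤ i := by
      have : (I0:ℝ) ≤ i := by
        have : (0:ℝ) ≤ n := by positivity
        linarith
      exact_mod_cast this
    have h7 := hI0 i hI
    rw [if_neg hin]
    have h8 : w ≤ c / 4 / (i + j) := by
      rw [le_div_iff₀ hNpos]
      have : (i:ℝ) * w ≤ c / 4 * (a / (4 * b)) := h7
      have h9 : a / (4 * b) * (((i:ℝ) + j) * w) ≤ a / (4 * b) * (c / 4) := by nlinarith
      have := le_of_mul_le_mul_left h9 hx1
      linarith
    have h10 : c / 2 / ((i:ℝ) + j) = 2 * (c / 4 / (i + j)) := by ring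
    rw [h10]
    have h11 : b * (1 + x) * w ≤ 2 * w := by gcongr
    have : a * w ≤ w := by nlinarith
    have h12 : b * x * w ≤ b * w := by
      have : b * x ≤ b := by nlinarith
      gcongr
    have h13 : 2 * (a * w) + b * w = w := by
      rw [show 2 * (a * w) + b * w = (2 * a + b) * w by ring, hab, one_mul]
    have h14 : b * (1 + x) * w = b * w + b * x * w := by ring
    have h15 : 0 < a * w := by positivity
    have h16 : 0 < b * w := by positivity
    rw [h14] at h2 h3
    linarith

lemma aux_q (n : ℕ) (N : ℝ) (hN : (n:ℝ) + 1 < N) :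
    (N / (N + 1)) ^ n ≤ N / (N + n) ∧ (N / (N - 1)) ^ n ≤ N / (N - n) := by
  have hn : (0:ℝ) ≤ n := by positivity
  have hNp : 0 < N := by linarith
  constructor
  · have h := one_add_mul_le_pow (a := 1 / N) (by have : 0 < 1 / N := by positivity
                                                  linarith) n
    have e1 : (N / (N + 1)) ^ n = 1 / (1 + 1 / N) ^ n := by
      rw [← one_div_pow]; congr 1; field_simp
    have e2 : N / (N + n) = 1 / (1 + n * (1 / N)) := by field_simp
    rw [e1, e2]
    exact one_div_le_one_div_of_le (by positivity) h
  · have hinv : 1 / N ≤ 1 := by rw [div_le_one hNp]; linarith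
    have h := one_add_mul_le_pow (a := - (1 / N)) (by linarith) n
    have hp : 0 < N - 1 := by linarith
    have hp' : 0 < N - n := by linarith
    have e1 : (N / (N - 1)) ^ n = 1 / (1 + -(1 / N)) ^ n := by
      rw [← one_div_pow]; congr 1; 
      have : 1 + -(1/N) = (N-1)/N := by field_simp; ring
      rw [this]; field_simp
    have e3 : 1 + (n:ℝ) * -(1 / N) = (N - n) / N := by field_simp; ring
    have e2 : N / (N - n) = 1 / (1 + n * -(1 / N)) := by rw [e3]; field_simp
    rw [e1, e2]
    exact one_div_le_one_div_of_le (by rw [e3]; positivity) h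

lemma aux_U (a b : ℝ) (ha : 0 < a) (hb : 0 < b) (hab : 2 * a + b = 1) (hba : b < 2 * a) (n : ℕ)
    (hn : 1 ≤ n) :
    ∃ c : ℝ, 0 < c ∧ ∃ N0 : ℕ, ∀ N : ℕ, N0 ≤ N →
      2 * a * ((N:ℝ) / (N + 1)) ^ n + b * ((N:ℝ) / (N - 1)) ^ n ≤ 1 - c / N ∧
      ((N:ℝ) / (N + 1)) ^ n ≤ 1 ∧ ((N:ℝ) / (N - 1)) ^ n ≤ 1 + a / 16 := by
  have hnR : (1:ℝ) ≤ n := by exact_mod_cast hn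
  refine ⟨n * (2 * a - b) / 2, by have : 0 < 2 * a - b := by linarith
                                  positivity, ?_⟩
  have key : ∀ᶠ N : ℕ in atTop, (n:ℝ) + 1 < N ∧ (n:ℝ) * 16 / a + n ≤ N ∧ 
      4 * n / (2 * a - b) + n ≤ (N:ℝ) := by
    have ht := tendsto_natCast_atTop_atTop (R := ℝ)
    exact (ht.eventually_gt_atTop _).and ((ht.eventually_ge_atTop _).and (ht.eventually_ge_atTop _))
  obtain ⟨N0, hN0⟩ := eventually_atTop.1 key
  refine ⟨N0, fun N hN => ?_⟩
  obtain ⟨h1, h2, h3⟩ := hN0 N hN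
  obtain ⟨q1, q2⟩ := aux_q n N h1
  have hNp : (0:ℝ) < N := by linarith
  have hp : (0:ℝ) < (N:ℝ) - n := by linarith
  have hs : 0 < 2 * a - b := by linarith
  refine ⟨?_, ?_, ?_⟩
  · have e1 : (N:ℝ) / (N + n) = 1 - n / (N + n) := by field_simp; ring
    have e2 : (N:ℝ) / (N - n) = 1 + n / (N - n) := by field_simp; ring
    have : 2 * a * ((N:ℝ) / (N + 1)) ^ n + b * ((N:ℝ) / (N - 1)) ^ n
       ≤ 2 * a * (N / (N + n)) + b * (N / (N - n)) := by gcongr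
    refine this.trans ?_
    rw [e1, e2]
    -- n/(N+n) ≥ n/N (1 - n/N); 
    have f1 : (n:ℝ) / N - n * n / (N * (N - n)) ≤ n / (N + n) := by
      rw [div_sub_div _ _ (by positivity) (by positivity), div_le_div_iff₀ (by positivity) (by positivity)]
      have : 0 ≤ (n:ℝ)^3 * N := by positivity
      have : 0 ≤ (n:ℝ)^3 * N * N:= by positivity
      have : 0 ≤ (n:ℝ)^2 * N * N:= by positivity
      nlinarith
    have f2 : (n:ℝ) / (N - n) = n / N + n * n / (N * (N - n)) := by field_simp; ring
    have f3 : (n:ℝ) * n / (N * (N - n)) ≤ n * (2 * a - b) / 2 / N / 2 := by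
      rw [div_div, div_div, div_le_div_iff₀ (by positivity) (by positivity)]
      have : 4 * n / (2 * a - b) ≤ (N:ℝ) - n := by linarith
      rw [div_le_iff₀ hs] at this
      have := mul_le_mul_of_nonneg_left this (show (0:ℝ) ≤ n * N by positivity)
      nlinarith
    rw [f2]
    set y := (n:ℝ) * n / (N * (N - n))
    have hy : 0 ≤ y := by positivity
    have f4 : 2 * a * ((n:ℝ) / N - y) ≤ 2 * a * (n / (N + n)) := by gcongr
    have f5 : n * (2 * a - b) / 2 / N = (2 * a - b) * ((n:ℝ) / N) / 2 := by ring
    rw [f5] at f3 ⊢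
    have f6 : 2 * a * y + b * y = y := by
      rw [show 2 * a * y + b * y = (2 * a + b) * y by ring, hab, one_mul]
    nlinarith
  · apply pow_le_one₀ (by positivity)
    rw [div_le_one (by positivity)]; linarith
  · refine q2.trans ?_
    rw [div_le_iff₀ hp]
    have : (n:ℝ) * 16 / a ≤ N - n := by linarith
    rw [div_le_iff₀ ha] at this
    nlinarith

lemma aux_crude (a b : ℝ) (ha : 0 < a) (hb : 0 < b) (hab : 2 * a + b = 1) (hba : b < 2 * a)
    (H : ℕ → ℕ → ℕ → ℝ) (h01 : ∀ T i j, 0 ≤ H T i j ∧ H T i j ≤ 1)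
    (h0 : ∀ i j, H 0 (i+1) (j+1) = 0)
    (hrec : ∀ T i j, H (T+1) (i+1) (j+1) = a * H T (i+2) (j+1) + a * H T (i+1) (j+2)
      + b * (((i+1:ℕ):ℝ) / (((i+1:ℕ):ℝ) + ((j+1:ℕ):ℝ))) * H T i (j+1)
      + b * (((j+1:ℕ):ℝ) / (((i+1:ℕ):ℝ) + ((j+1:ℕ):ℝ))) * H T (i+1) j) (n : ℕ) :
    ∃ K : ℝ, 0 ≤ K ∧ ∀ T i j, n ≤ i → n ≤ j → H T i j ≤ K / ((i:ℝ) + j) ^ n := by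
  induction n with
  | zero => exact ⟨1, by norm_num, fun T i j _ _ => by simpa using (h01 T i j).2⟩
  | succ m ih =>
    obtain ⟨K, hK0, hK⟩ := ih
    set n := m + 1 with hn
    obtain ⟨c, hc, N1, hN1⟩ := aux_U a b ha hb hab hba n (by omega)
    obtain ⟨N2, hN2⟩ := aux_V a b c ha hb hab hc n
    set N0 := N1 + N2 + 2 with hN0
    set δ : ℝ := a / 8 * (1/2:ℝ)^n with hδ
    have hδp : 0 < δ := by positivity
    set A : ℝ := 2 * n * K / δ + (N0:ℝ)^n with hA
    have hA1 : 2 * n * K ≤ A * δ := by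
      rw [hA, add_mul, div_mul_cancel₀ _ hδp.ne']
      have : 0 ≤ (N0:ℝ)^n * δ := by positivity
      linarith
    have hA2 : (N0:ℝ)^n ≤ A := by
      have : 0 ≤ 2 * n * K / δ := by positivity
      linarith
    have hA0 : 0 ≤ A := le_trans (by positivity) hA2
    have main : ∀ T i j, n ≤ i → n ≤ j →
        H T i j ≤ A / ((i:ℝ) + j) ^ n * (1 + (1/2:ℝ)^i + (1/2:ℝ)^j) := by
      intro T
      induction T with
      | zero =>
        intro i j hi hj
        obtain ⟨i, rfl⟩ : ∃ k, i = k + 1 := ⟨i - 1, by omega⟩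
        obtain ⟨j, rfl⟩ : ∃ k, j = k + 1 := ⟨j - 1, by omega⟩
        rw [h0]
        positivity
      | succ T ihT =>
        intro i j hi hj
        have hNpos : (0:ℝ) < (i:ℝ) + j := by
          have : 0 < i + j := by omega
          exact_mod_cast this
        by_cases hsmall : i + j ≤ N0
        · have hs : ((i:ℝ) + j) ≤ N0 := by exact_mod_cast hsmall
          have h1 : 1 ≤ A / ((i:ℝ) + j) ^ n := by
            rw [le_div_iff₀ (by positivity), one_mul]
            refine le_trans ?_ hA2
            gcongr
          have h2 : (1:ℝ) ≤ (1 + (1/2:ℝ)^i + (1/2:ℝ)^j) := by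
            have : (0:ℝ) < (1/2:ℝ)^i := by positivity
            have : (0:ℝ) < (1/2:ℝ)^j := by positivity
            linarith
          have := (h01 (T+1) i j).2
          nlinarith
        · push Not at hsmall
          set N : ℝ := (i:ℝ) + j with hN
          have hN2' : (2:ℝ) < N := by
            have : 2 < i + j := by omega
            rw [hN]; exact_mod_cast this
          obtain ⟨u1, u2, u3⟩ := hN1 (i + j) (by omega)
          have hcast : ((i + j : ℕ) : ℝ) = N := by push_cast; rfl
          rw [hcast] at u1 u2 u3
          set l := (N / (N + 1)) ^ n with hl
          set μ := (N / (N - 1)) ^ n with hμ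
          have hNm : 0 < N - 1 := by linarith
          have hl0 : 0 ≤ l := by positivity
          have hμ0 : 0 ≤ μ := by positivity
          have v1 := hN2 i j (by omega) hi l μ hl0 u2 hμ0 u3
          have v2 := hN2 j i (by omega) hj l μ hl0 u2 hμ0 u3
          rw [add_comm (j:ℝ) (i:ℝ)] at v2
          rw [← hN] at v1 v2
          set q : ℝ := 1 / N ^ n with hq
          have hq0 : 0 < q := by positivity
          have hqp : 1 / (N + 1) ^ n = l * q := by
            rw [hl, hq, div_pow]; field_simp
          have hqm : 1 / (N - 1) ^ n = μ * q := by
            rw [hμ, hq, div_pow]; field_simp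
          have hbig : ∀ k : ℕ, k = n → ∀ z : ℝ, 0 ≤ z → z ≤ K / (N - 1) ^ m →
              b * ((k:ℝ) / N) * z ≤ A * q * δ := by
            intro k hk z hz0 hz
            have e : K / (N - 1) ^ m = K * (N - 1) * (μ * q) := by
              rw [← hqm, hn, pow_succ]; field_simp
            rw [e] at hz
            have hμ2 : μ ≤ 2 := by linarith
            have hb1 : b ≤ 1 := by linarith
            have hz' : z ≤ K * N * (2 * q) := by
              refine hz.trans ?_
              gcongr
              linarith
            calc b * ((k:ℝ) / N) * z ≤ 1 * ((k:ℝ) / N) * (K * N * (2 * q)) := by gcongr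
              _ = (2 * n * K) * q := by rw [hk]; field_simp
              _ ≤ (A * δ) * q := by gcongr
              _ = _ := by ring
          obtain ⟨i, rfl⟩ : ∃ k, i = k + 1 := ⟨i - 1, by omega⟩
          obtain ⟨j, rfl⟩ : ∃ k, j = k + 1 := ⟨j - 1, by omega⟩
          rw [hrec, ← hN, div_eq_mul_one_div A, ← hq]
          have b1 := ihT (i+2) (j+1) (by omega) hj
          have b2 := ihT (i+1) (j+2) hi (by omega)
          have c1 : (((i+2:ℕ):ℝ) + ((j+1:ℕ):ℝ)) = N + 1 := by rw [hN]; push_cast; ring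
          have c2 : (((i+1:ℕ):ℝ) + ((j+2:ℕ):ℝ)) = N + 1 := by rw [hN]; push_cast; ring
          have c3 : ((i:ℝ) + ((j+1:ℕ):ℝ)) = N - 1 := by rw [hN]; push_cast; ring
          have c4 : (((i+1:ℕ):ℝ) + (j:ℝ)) = N - 1 := by rw [hN]; push_cast; ring
          rw [c1, div_eq_mul_one_div A, hqp] at b1
          rw [c2, div_eq_mul_one_div A, hqp] at b2
          set wi : ℝ := (1/2:ℝ)^(i+1) with hwi
          set wj : ℝ := (1/2:ℝ)^(j+1) with hwj
          have ei : (1/2:ℝ)^(i+2) = wi / 2 := by rw [hwi]; ring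
          have ej : (1/2:ℝ)^(j+2) = wj / 2 := by rw [hwj]; ring
          have ei' : (1/2:ℝ)^i = 2 * wi := by rw [hwi]; ring
          have ej' : (1/2:ℝ)^j = 2 * wj := by rw [hwj]; ring
          rw [ei] at b1
          rw [ej] at b2
          have hwi0 : 0 < wi := by positivity
          have hwj0 : 0 < wj := by positivity
          have b3 : b * (((i+1:ℕ):ℝ) / N) * H T i (j+1) ≤
              b * (((i+1:ℕ):ℝ) / N) * (A * (μ * q) * (1 + 2 * wi + wj))
                + A * q * (if i + 1 = n then δ else 0) := by
            split_ifs with h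
            · have := hK T i (j+1) (by omega) (by omega)
              rw [c3] at this
              have := hbig (i+1) h _ (h01 T i (j+1)).1 this
              have : 0 ≤ b * (((i+1:ℕ):ℝ) / N) * (A * (μ * q) * (1 + 2 * wi + wj)) := by positivity
              linarith
            · have := ihT i (j+1) (by omega) hj
              rw [c3, div_eq_mul_one_div A, hqm, ei'] at this
              rw [mul_zero, add_zero]
              gcongr
          have b4 : b * (((j+1:ℕ):ℝ) / N) * H T (i+1) j ≤
              b * (((j+1:ℕ):ℝ) / N) * (A * (μ * q) * (1 + wi + 2 * wj))
                + A * q * (if j + 1 = n then δ else 0) := by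
            split_ifs with h
            · have := hK T (i+1) j (by omega) (by omega)
              rw [c4] at this
              have := hbig (j+1) h _ (h01 T (i+1) j).1 this
              have : 0 ≤ b * (((j+1:ℕ):ℝ) / N) * (A * (μ * q) * (1 + wi + 2 * wj)) := by positivity
              linarith
            · have := ihT (i+1) j hi (by omega)
              rw [c4, div_eq_mul_one_div A, hqm, ej'] at this
              rw [mul_zero, add_zero]
              gcongr
          have b1' := mul_le_mul_of_nonneg_left b1 ha.le
          have b2' := mul_le_mul_of_nonneg_left b2 ha.le
          have hxy : ((i+1:ℕ):ℝ) / N + ((j+1:ℕ):ℝ) / N = 1 := by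
            rw [← add_div, ← hN]; exact div_self hNpos.ne'
          generalize ((i+1:ℕ):ℝ) / N = x at *
          generalize ((j+1:ℕ):ℝ) / N = y at *
          obtain rfl : y = 1 - x := by linarith
          generalize (if i + 1 = n then δ else 0) = Di at *
          generalize (if j + 1 = n then δ else 0) = Dj at *
          have hsum : (2 * a * l + b * μ) + ((a * (wi / 2) + a * wi) * l + (b * x * (2 * wi) + b * (1 - x) * wi) * μ + Di)
              + ((a * (wj / 2) + a * wj) * l + (b * (1 - x) * (2 * wj) + b * x * wj) * μ + Dj)
              ≤ 1 + wi + wj := by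
            have : c / 2 / N = c / N / 2 := by ring
            rw [this] at v1 v2
            linarith
          have hAq : 0 ≤ A * q := by positivity
          have := mul_le_mul_of_nonneg_left hsum hAq
          refine (add_le_add (add_le_add (add_le_add b1' b2') b3) b4).trans (le_trans (le_of_eq ?_) this)
          ring
    refine ⟨A * 3, by positivity, fun T i j hi hj => (main T i j hi hj).trans ?_⟩
    have h1 : (1/2:ℝ)^i ≤ 1 := pow_le_one₀ (by norm_num) (by norm_num)
    have h2 : (1/2:ℝ)^j ≤ 1 := pow_le_one₀ (by norm_num) (by norm_num)
    rw [mul_div_right_comm]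
    gcongr
    linarith

lemma aux_powp (i : ℕ) : (fun j : ℕ => 1 / ((j:ℝ) + 1) ^ i - 1 / (j:ℝ) ^ i)
    =O[atTop] (fun j : ℕ => 1 / (j : ℝ) ^ (i + 1)) := by
  refine IsBigO.of_bound (i:ℝ) ?_
  filter_upwards [eventually_gt_atTop (i + 1)] with j hj
  have hjR : (i:ℝ) + 1 < j := by exact_mod_cast hj
  have hi0 : (0:ℝ) ≤ i := by positivity
  have hj0 : (0:ℝ) < j := by linarith
  have h1 : ((j:ℝ) / (j + 1)) ^ i ≤ 1 := by
    apply pow_le_one₀ (by positivity)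
    rw [div_le_one (by positivity)]; linarith
  have h2 : 1 - (i:ℝ) / j ≤ ((j:ℝ) / (j + 1)) ^ i := by
    have hinv : 1 / ((j:ℝ) + 1) ≤ 1 := by rw [div_le_one (by positivity)]; linarith
    have h := one_add_mul_le_pow (a := - (1 / ((j:ℝ) + 1))) (by linarith) i
    have e : 1 + - (1 / ((j:ℝ) + 1)) = j / (j + 1) := by field_simp; ring
    rw [e] at h
    have : (i:ℝ) * (1 / (j + 1)) ≤ i / j := by
      rw [mul_one_div]; gcongr; linarith
    linarith
  have e1 : 1 / ((j:ℝ) + 1) ^ i - 1 / (j:ℝ) ^ i = (((j:ℝ) / (j + 1)) ^ i - 1) * (1 / (j:ℝ) ^ i) := by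
    rw [div_pow]; field_simp
  have e2 : (i:ℝ) * (1 / (j:ℝ) ^ (i + 1)) = (i / j) * (1 / (j:ℝ) ^ i) := by
    rw [pow_succ]; field_simp
  have hp : 0 < 1 / (j:ℝ) ^ i := by positivity
  rw [e1, Real.norm_of_nonneg (show 0 ≤ 1 / (j:ℝ) ^ (i + 1) by positivity), e2, norm_mul,
    Real.norm_of_nonneg hp.le, Real.norm_eq_abs]
  gcongr
  rw [abs_le]
  have : 0 ≤ (i:ℝ) / j := by positivity
  constructor <;> linarith

lemma aux_powm (i : ℕ) : (fun j : ℕ => 1 / ((j:ℝ) - 1) ^ i - 1 / (j:ℝ) ^ i)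
    =O[atTop] (fun j : ℕ => 1 / (j : ℝ) ^ (i + 1)) := by
  refine IsBigO.of_bound (2 * i:ℝ) ?_
  filter_upwards [eventually_gt_atTop (2 * i + 1)] with j hj
  have hjR : 2 * (i:ℝ) + 1 < j := by exact_mod_cast hj
  have hi0 : (0:ℝ) ≤ i := by positivity
  have hj0 : (0:ℝ) < j := by linarith
  have hjm : (0:ℝ) < (j:ℝ) - 1 := by linarith
  have h1 : 1 ≤ ((j:ℝ) / (j - 1)) ^ i := by
    apply one_le_pow₀
    rw [le_div_iff₀ hjm]; linarith
  have h2 := (aux_q i j (by linarith)).2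
  have h3 : (j:ℝ) / (j - i) ≤ 1 + 2 * i / j := by
    have : (0:ℝ) < (j:ℝ) - i := by linarith
    have e : 1 + 2 * (i:ℝ) / j = (j + 2 * i) / j := by field_simp
    rw [e, div_le_div_iff₀ this hj0]
    nlinarith
  have e1 : 1 / ((j:ℝ) - 1) ^ i - 1 / (j:ℝ) ^ i = (((j:ℝ) / (j - 1)) ^ i - 1) * (1 / (j:ℝ) ^ i) := by
    rw [div_pow]; field_simp
  have e2 : 2 * (i:ℝ) * (1 / (j:ℝ) ^ (i + 1)) = (2 * i / j) * (1 / (j:ℝ) ^ i) := by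
    rw [pow_succ]; field_simp
  have hp : 0 < 1 / (j:ℝ) ^ i := by positivity
  rw [e1, Real.norm_of_nonneg (show 0 ≤ 1 / (j:ℝ) ^ (i + 1) by positivity), e2, norm_mul,
    Real.norm_of_nonneg hp.le, Real.norm_eq_abs]
  gcongr
  rw [abs_le]
  have : 0 ≤ 2 * (i:ℝ) / j := by positivity
  constructor <;> linarith

lemma aux_max (a b : ℝ) (ha : 0 < a) (hb : 0 < b) (hab : a + b < 1) (E R : ℕ → ℝ) (M : ℝ)
    (hE0 : ∀ j, 0 ≤ E j) (hE : ∀ j, E j ≤ M) (n : ℕ)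
    (hrec : ∀ᶠ j : ℕ in atTop, E j ≤ a * E (j + 1) + b * E (j - 1) + R j)
    (hR : R =O[atTop] (fun j : ℕ => 1 / (j : ℝ) ^ n)) :
    E =O[atTop] (fun j : ℕ => 1 / (j : ℝ) ^ n) := by
  obtain ⟨K, hK0, hK⟩ := hR.exists_pos
  have hM : 0 ≤ M := (hE0 0).trans (hE 0)
  set η : ℝ := (1 - a - b) / 2 with hη
  have hηp : 0 < η := by rw [hη]; linarith
  have ht := tendsto_natCast_atTop_atTop (R := ℝ)
  have hall := hrec.and ((hK.bound).and ((ht.eventually_gt_atTop ((n:ℝ) + 1)).and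
    (ht.eventually_ge_atTop ((n:ℝ) / η + n))))
  obtain ⟨J, hJ⟩ := eventually_atTop.1 hall
  set C : ℝ := K / η + M * (J:ℝ) ^ n with hC
  have hC0 : 0 ≤ C := by positivity
  have hC1 : K ≤ C * η := by
    rw [hC, add_mul, div_mul_cancel₀ _ hηp.ne']
    have : 0 ≤ M * (J:ℝ)^n * η := by positivity
    linarith
  have hC2 : M * (J:ℝ) ^ n ≤ C := by
    have : 0 ≤ K / η := by positivity
    linarith
  have main : ∀ k : ℕ, ∀ j : ℕ, 1 ≤ j → E j - C * (1 / (j:ℝ) ^ n) ≤ (a + b) ^ k * M := by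
    intro k
    induction k with
    | zero =>
      intro j hj
      have : 0 ≤ C * (1 / (j:ℝ) ^ n) := by positivity
      have := hE j
      simp only [pow_zero, one_mul]
      linarith
    | succ k ih =>
      intro j hj
      have hj0 : (0:ℝ) < j := by exact_mod_cast hj
      by_cases hjJ : j ≤ J
      · have : M ≤ C * (1 / (j:ℝ) ^ n) := by
          rw [mul_one_div, le_div_iff₀ (by positivity)]
          refine le_trans ?_ hC2
          gcongr
        have h1 := hE j
        have : 0 ≤ (a + b) ^ (k + 1) * M := by positivity
        linarith
      · push Not at hjJ
        obtain ⟨r1, r2, r3, r4⟩ := hJ j hjJ.le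
        have hn0 : (0:ℝ) ≤ n := by positivity
        have hj2 : 2 ≤ j := by
          have : (1:ℝ) < j := by linarith
          have : 1 < j := by exact_mod_cast this
          omega
        have hjm : (0:ℝ) < (j:ℝ) - 1 := by linarith
        have i1 := ih (j + 1) (by omega)
        have i2 := ih (j - 1) (by omega)
        have cm : ((j - 1 : ℕ) : ℝ) = (j:ℝ) - 1 := by push_cast [hj]; ring
        rw [cm] at i2
        push_cast at i1
        set q := 1 / (j:ℝ) ^ n with hq
        have hq0 : 0 < q := by positivity
        have e1 : 1 / ((j:ℝ) + 1) ^ n ≤ q := by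
          rw [hq]; gcongr; linarith
        have hp : (0:ℝ) < (j:ℝ) - n := by linarith
        have e2 : b * (1 / ((j:ℝ) - 1) ^ n) ≤ (b + η) * q := by
          have h2 := (aux_q n j r3).2
          have h3 : (j:ℝ) / (j - n) ≤ 1 + η := by
            rw [div_le_iff₀ hp]
            have : (n:ℝ) / η ≤ j - n := by linarith
            rw [div_le_iff₀ hηp] at this
            nlinarith
          have h4 : 1 / ((j:ℝ) - 1) ^ n = ((j:ℝ) / (j - 1)) ^ n * q := by
            rw [hq, div_pow]; field_simp
          rw [h4]
          have h5 : ((j:ℝ) / (j - 1)) ^ n * q ≤ (1 + η) * q := by gcongr; linarith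
          have h6 : b * (η * q) ≤ 1 * (η * q) := by gcongr; linarith
          nlinarith
        rw [Real.norm_of_nonneg hq0.le] at r2
        have r2' : R j ≤ K * q := (le_abs_self _).trans r2
        have f1 : K * q ≤ C * η * q := by gcongr
        have i1' := mul_le_mul_of_nonneg_left i1 ha.le
        have i2' := mul_le_mul_of_nonneg_left i2 hb.le
        have e1' := mul_le_mul_of_nonneg_left e1 (show 0 ≤ C * a by positivity)
        have e2' := mul_le_mul_of_nonneg_left e2 hC0
        have e3 : C * a * q + C * ((b + η) * q) + C * η * q = C * q := by
          rw [hη]; ring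
        rw [pow_succ]
        linarith
  refine IsBigO.of_bound C ?_
  filter_upwards [eventually_ge_atTop 1] with j hj
  have hl : Tendsto (fun k : ℕ => (a + b) ^ k * M) atTop (nhds (0 * M)) :=
    (tendsto_pow_atTop_nhds_zero_of_lt_one (by positivity) hab).mul_const M
  have := ge_of_tendsto' hl (fun k => main k j hj)
  rw [Real.norm_of_nonneg (hE0 j), Real.norm_of_nonneg (by positivity)]
  linarith

lemma aux_fine (a b : ℝ) (ha : 0 < a) (hb : 0 < b) (hab : 2 * a + b = 1)
    (P : ℕ → ℕ → ℝ) (h01 : ∀ i j, 0 ≤ P i j ∧ P i j ≤ 1) (h0 : ∀ j, P 0 j = 1)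
    (hrec : ∀ i j, P (i+1) (j+1) = a * P (i+2) (j+1) + a * P (i+1) (j+2)
      + b * (((i+1:ℕ):ℝ) / (((i+1:ℕ):ℝ) + ((j+1:ℕ):ℝ))) * P i (j+1)
      + b * (((j+1:ℕ):ℝ) / (((i+1:ℕ):ℝ) + ((j+1:ℕ):ℝ))) * P (i+1) j)
    (hcr : ∀ n : ℕ, (fun j : ℕ => P n j) =O[atTop] (fun j : ℕ => 1 / (j : ℝ) ^ n)) (i : ℕ) :
    (fun j : ℕ => P i j - (b / a) ^ i * (Nat.factorial i : ℝ) / (j : ℝ) ^ i)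
      =O[atTop] (fun j : ℕ => 1 / (j : ℝ) ^ (i + 1)) := by
  induction i with
  | zero => 
    simp only [h0]
    simpa using isBigO_zero _ _
  | succ i ih =>
    set c0 : ℝ := (b / a) ^ i * (Nat.factorial i : ℝ) with hc0
    set c : ℝ := (b / a) ^ (i+1) * (Nat.factorial (i+1) : ℝ) with hc
    have hcc : a * c = b * (i + 1) * c0 := by
      rw [hc, hc0, Nat.factorial_succ, pow_succ]; push_cast; field_simp
    have hcp : 0 < c := by positivity
    have hc0p : 0 < c0 := by positivity
    have ht := tendsto_natCast_atTop_atTop (R := ℝ)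
    set x : ℕ → ℝ := fun j => ((i+1:ℕ):ℝ) / (((i+1:ℕ):ℝ) + (j:ℝ)) with hx
    have hxO : x =O[atTop] (fun j : ℕ => 1 / (j:ℝ)) := by
      refine IsBigO.of_bound ((i+1:ℕ):ℝ) ?_
      filter_upwards [eventually_gt_atTop 0] with j hj
      have hj0 : (0:ℝ) < j := by exact_mod_cast hj
      rw [Real.norm_of_nonneg (by positivity), Real.norm_of_nonneg (by positivity), mul_one_div]
      simp only [hx]
      gcongr
      have : (0:ℝ) ≤ ((i+1:ℕ):ℝ) := by positivity
      linarith
    have hyO : (fun j => x j - ((i:ℝ)+1) / j) =O[atTop] (fun j : ℕ => 1 / (j:ℝ) ^ 2) := by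
      refine IsBigO.of_bound (((i:ℝ)+1)^2) ?_
      filter_upwards [eventually_gt_atTop 0] with j hj
      have hj0 : (0:ℝ) < j := by exact_mod_cast hj
      have e : x j - ((i:ℝ)+1) / j = - (((i:ℝ)+1)^2 / ((i + 1 + j) * j)) := by
        simp only [hx]; push_cast; field_simp; ring
      rw [e, norm_neg, Real.norm_of_nonneg (by positivity), Real.norm_of_nonneg (by positivity), mul_one_div,
        pow_two (j:ℝ)]
      gcongr
      have : (0:ℝ) ≤ i := by positivity
      linarith
    set R : ℕ → ℝ := fun j => a * c * (1 / ((j:ℝ) + 1) ^ (i+1) - 1 / (j:ℝ) ^ (i+1))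
      + b * c * (1 / ((j:ℝ) - 1) ^ (i+1) - 1 / (j:ℝ) ^ (i+1))
      - b * c * (x j * (1 / ((j:ℝ) - 1) ^ (i+1)))
      + a * P (i+2) j + b * (x j * (P i j - c0 / (j:ℝ) ^ i))
      + b * c0 * ((x j - ((i:ℝ)+1) / j) * (1 / (j:ℝ) ^ i)) with hRdef
    have hR : R =O[atTop] (fun j : ℕ => 1 / (j : ℝ) ^ (i + 2)) := by
      have p1 := aux_powp (i+1)
      have p2 := aux_powm (i+1)
      have p0 : (fun j : ℕ => 1 / ((j:ℝ) - 1) ^ (i+1)) =O[atTop] (fun j : ℕ => 1 / (j : ℝ) ^ (i + 1)) := by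
        have h1 : (fun j : ℕ => 1 / (j : ℝ) ^ (i + 1 + 1)) =O[atTop] (fun j : ℕ => 1 / (j : ℝ) ^ (i + 1)) := by
          refine IsBigO.of_bound 1 ?_
          filter_upwards [eventually_gt_atTop 0] with j hj
          have hj1 : (1:ℝ) ≤ j := by exact_mod_cast hj
          rw [Real.norm_of_nonneg (by positivity), Real.norm_of_nonneg (by positivity), one_mul]
          gcongr
          omega
        have := (p2.trans h1).add (isBigO_refl (fun j : ℕ => 1 / (j : ℝ) ^ (i + 1)) atTop)
        refine this.congr_left (fun j => by ring)
      have p3 : (fun j : ℕ => x j * (1 / ((j:ℝ) - 1) ^ (i+1))) =O[atTop] (fun j : ℕ => 1 / (j : ℝ) ^ (i + 2)) := by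
        refine (hxO.mul p0).congr_right (fun j => ?_)
        rw [one_div_mul_one_div]; congr 1; ring
      have p4 : (fun j : ℕ => x j * (P i j - c0 / (j:ℝ) ^ i)) =O[atTop] (fun j : ℕ => 1 / (j : ℝ) ^ (i + 2)) := by
        refine (hxO.mul ih).congr_right (fun j => ?_)
        rw [one_div_mul_one_div]; congr 1; ring
      have p5 : (fun j : ℕ => (x j - ((i:ℝ)+1) / j) * (1 / (j:ℝ) ^ i)) =O[atTop] (fun j : ℕ => 1 / (j : ℝ) ^ (i + 2)) := by
        refine (hyO.mul (isBigO_refl (fun j : ℕ => 1 / (j : ℝ) ^ i) atTop)).congr_right (fun j => ?_)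
        rw [one_div_mul_one_div]; congr 1; ring
      exact (((((p1.const_mul_left (a * c)).add (p2.const_mul_left (b * c))).sub
        (p3.const_mul_left (b * c))).add ((hcr (i+2)).const_mul_left a)).add
        (p4.const_mul_left b)).add (p5.const_mul_left (b * c0))
    set e : ℕ → ℝ := fun j => P (i+1) j - c / (j:ℝ) ^ (i+1) with he
    have hbound : ∀ j, |e j| ≤ 1 + c := by
      intro j
      have h1 := h01 (i+1) j
      have h2 : 0 ≤ c / (j:ℝ) ^ (i+1) := by positivity
      have h3 : c / (j:ℝ) ^ (i+1) ≤ c := by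
        rcases Nat.eq_zero_or_pos j with rfl | hj
        · simp [hcp.le]
        · apply div_le_self hcp.le
          apply one_le_pow₀
          exact_mod_cast hj
      rw [abs_le]; simp only [he]
      constructor <;> linarith
    have := aux_max a b ha hb (by linarith) (fun j => |e j|) (fun j => |R j|) (1 + c)
      (fun j => abs_nonneg _) hbound (i + 2) ?_ hR.norm_left
    · exact (isBigO_norm_left (f' := e)).1 this
    · filter_upwards [eventually_ge_atTop 2] with j hj
      have key : e j = a * e (j+1) + b * (1 - x j) * e (j-1) + R j := by
        obtain ⟨k, rfl⟩ : ∃ k, j = k + 1 := ⟨j - 1, by omega⟩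
        have hk : (0:ℝ) < k := by
          have : 0 < k := by omega
          exact_mod_cast this
        have hy : ((k+1:ℕ):ℝ) / (((i+1:ℕ):ℝ) + ((k+1:ℕ):ℝ)) = 1 - x (k+1) := by
          simp only [hx]; push_cast; field_simp; ring
        have hr := hrec i k
        rw [hy] at hr
        rw [show ((i+1:ℕ):ℝ) / (((i+1:ℕ):ℝ) + ((k+1:ℕ):ℝ)) = x (k+1) from rfl] at hr
        simp only [he, hRdef]
        rw [hr, Nat.add_sub_cancel]
        generalize x (k+1) = X
        have cm : ((k+1:ℕ):ℝ) - 1 = k := by push_cast; ring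
        have cp : ((k+1+1:ℕ):ℝ) = ((k+1:ℕ):ℝ) + 1 := by push_cast; ring
        rw [cm, cp]
        have hJ : (0:ℝ) < ((k+1:ℕ):ℝ) := by positivity
        generalize ((k+1:ℕ):ℝ) = J at *
        have e1 : ((i:ℝ)+1) / J * (1 / J ^ i) = (i+1) * (1 / J ^ (i+1)) := by
          rw [pow_succ]; field_simp
        have e2 : (1:ℝ) = 2 * a + b := hab.symm
        have e3 : b * c0 * ((X - ((i:ℝ)+1) / J) * (1 / J ^ i))
            = b * c0 * X * (1 / J ^ i) - a * c * (1 / J ^ (i+1)) := by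
          rw [hcc, sub_mul, e1]; ring
        rw [e3, div_eq_mul_one_div c, div_eq_mul_one_div c, div_eq_mul_one_div c, div_eq_mul_one_div c0]
        linear_combination (-c * (1 / J ^ (i+1))) * e2
      have hx0 : 0 ≤ x j := by positivity
      have hx1 : x j ≤ 1 := by
        simp only [hx]
        rw [div_le_one (by positivity)]
        have : (0:ℝ) ≤ j := by positivity
        linarith
      calc |e j| = |a * e (j+1) + b * (1 - x j) * e (j-1) + R j| := by rw [← key]
        _ ≤ |a * e (j+1)| + |b * (1 - x j) * e (j-1)| + |R j| := abs_add_three _ _ _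
        _ ≤ a * |e (j+1)| + b * |e (j-1)| + |R j| := by
          rw [abs_mul, abs_mul, abs_of_pos ha, abs_of_nonneg (show 0 ≤ b * (1 - x j) from
            mul_nonneg hb.le (by linarith))]
          gcongr
          nlinarith

lemma hit_axis (r d : ℝ) (T i j : ℕ) (h : i = 0 ∨ j = 0) : hitProbAux r d T (i, j) = 1 := by
  cases T <;> simp [hitProbAux, h]

lemma hit_rec (r d : ℝ) (T i j : ℕ) :
    hitProbAux r d (T+1) (i+1, j+1) = r / (2 * (r + d)) * hitProbAux r d T (i+2, j+1)
      + r / (2 * (r + d)) * hitProbAux r d T (i+1, j+2)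
      + d / (r + d) * (((i+1:ℕ):ℝ) / (((i+1:ℕ):ℝ) + ((j+1:ℕ):ℝ))) * hitProbAux r d T (i, j+1)
      + d / (r + d) * (((j+1:ℕ):ℝ) / (((i+1:ℕ):ℝ) + ((j+1:ℕ):ℝ))) * hitProbAux r d T (i+1, j) := by
  rw [hitProbAux, if_neg (by simp)]
  simp only [Nat.add_sub_cancel]
  rw [div_mul_div_comm, div_mul_div_comm]

lemma hit_bds (r d : ℝ) (hr : 0 < r) (hd : 0 < d) (T : ℕ) : ∀ i j : ℕ,
    0 ≤ hitProbAux r d T (i, j) ∧ hitProbAux r d T (i, j) ≤ 1 ∧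
      hitProbAux r d T (i, j) ≤ hitProbAux r d (T+1) (i, j) := by
  have hnn : ∀ T i j : ℕ, 0 ≤ hitProbAux r d T (i, j) := by
    intro T
    induction T with
    | zero => intro i j; simp only [hitProbAux]; split_ifs <;> norm_num
    | succ T ih =>
      intro i j
      rcases i with _ | i
      · rw [hit_axis _ _ _ _ _ (Or.inl rfl)]; norm_num
      rcases j with _ | j
      · rw [hit_axis _ _ _ _ _ (Or.inr rfl)]; norm_num
      rw [hit_rec]
      have := ih (i+2) (j+1)
      have := ih (i+1) (j+2)
      have := ih i (j+1)
      have := ih (i+1) j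
      positivity
  induction T with
  | zero =>
    intro i j
    refine ⟨hnn _ _ _, ?_, ?_⟩
    · simp only [hitProbAux]; split_ifs <;> norm_num
    · by_cases h : i = 0 ∨ j = 0
      · rw [hit_axis _ _ _ _ _ h, hit_axis _ _ _ _ _ h]
      · have : hitProbAux r d 0 (i, j) = 0 := by simp only [hitProbAux]; rw [if_neg h]
        rw [this]; exact hnn _ _ _
  | succ T ih =>
    intro i j
    refine ⟨hnn _ _ _, ?_⟩
    rcases i with _ | i
    · rw [hit_axis _ _ _ _ _ (Or.inl rfl), hit_axis _ _ _ _ _ (Or.inl rfl)]; norm_num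
    rcases j with _ | j
    · rw [hit_axis _ _ _ _ _ (Or.inr rfl), hit_axis _ _ _ _ _ (Or.inr rfl)]; norm_num
    obtain ⟨-, b1, m1⟩ := ih (i+2) (j+1)
    obtain ⟨-, b2, m2⟩ := ih (i+1) (j+2)
    obtain ⟨-, b3, m3⟩ := ih i (j+1)
    obtain ⟨-, b4, m4⟩ := ih (i+1) j
    constructor
    · rw [hit_rec]
      calc _ ≤ r / (2 * (r + d)) * 1 + r / (2 * (r + d)) * 1
            + d / (r + d) * (((i+1:ℕ):ℝ) / (((i+1:ℕ):ℝ) + ((j+1:ℕ):ℝ))) * 1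
            + d / (r + d) * (((j+1:ℕ):ℝ) / (((i+1:ℕ):ℝ) + ((j+1:ℕ):ℝ))) * 1 := by gcongr
        _ = 1 := by
          have : (0:ℝ) < (((i+1:ℕ):ℝ) + ((j+1:ℕ):ℝ)) := by positivity
          field_simp
          ring
    · rw [hit_rec, hit_rec r d (T+1)]
      gcongr

/-- for fixed `i ≥ 1`, as `j → ∞`,
`p_{i,j} = (2d/r)^i · i! / j^i + O(1/j^(i+1))`. -/
theorem extinctionProb_asymptotics_fixed_row (r d : ℝ) (hd : 0 < d) (hrd : d < r)
    (i : ℕ) (hi : 1 ≤ i) :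
    (fun j : ℕ =>
        extinctionProb r d i j - (2 * d / r) ^ i * (Nat.factorial i : ℝ) / (j : ℝ) ^ i)
      =O[atTop] (fun j : ℕ => 1 / (j : ℝ) ^ (i + 1)) := by
  have hr : 0 < r := hd.trans hrd
  have ha : 0 < r / (2 * (r + d)) := by positivity
  have hb : 0 < d / (r + d) := by positivity
  have hab : 2 * (r / (2 * (r + d))) + d / (r + d) = 1 := by field_simp
  have hba : d / (r + d) < 2 * (r / (2 * (r + d))) := by
    have : 2 * (r / (2 * (r + d))) = r / (r + d) := by field_simp
    rw [this]; gcongr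
  have hq : d / (r + d) / (r / (2 * (r + d))) = 2 * d / r := by field_simp
  have bds := hit_bds r d hr hd
  have hlim : ∀ i j, Tendsto (fun T => hitProbAux r d T (i, j)) atTop
      (nhds (extinctionProb r d i j)) := by
    intro i j
    refine tendsto_atTop_ciSup (monotone_nat_of_le_succ fun T => (bds T i j).2.2) ⟨1, ?_⟩
    rintro _ ⟨T, rfl⟩
    exact (bds T i j).2.1
  rw [← hq]
  refine aux_fine _ _ ha hb hab (extinctionProb r d) ?_ ?_ ?_ ?_ i
  · intro i j
    exact ⟨ge_of_tendsto' (hlim i j) fun T => (bds T i j).1,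
      le_of_tendsto' (hlim i j) fun T => (bds T i j).2.1⟩
  · intro j
    refine tendsto_nhds_unique (hlim 0 j) ?_
    simp only [hit_axis r d _ 0 j (Or.inl rfl)]
    exact tendsto_const_nhds
  · intro i j
    have h1 := (hlim (i+1) (j+1)).comp (tendsto_add_atTop_nat 1)
    refine tendsto_nhds_unique h1 ?_
    have h2 := ((((hlim (i+2) (j+1)).const_mul (r / (2 * (r + d)))).add
      ((hlim (i+1) (j+2)).const_mul (r / (2 * (r + d))))).add
      ((hlim i (j+1)).const_mul (d / (r + d) * (((i+1:ℕ):ℝ) / (((i+1:ℕ):ℝ) + ((j+1:ℕ):ℝ)))))).add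
      ((hlim (i+1) j).const_mul (d / (r + d) * (((j+1:ℕ):ℝ) / (((i+1:ℕ):ℝ) + ((j+1:ℕ):ℝ)))))
    refine h2.congr fun T => ?_
    exact (hit_rec r d T i j).symm
  · intro n
    obtain ⟨K, hK0, hK⟩ := aux_crude _ _ ha hb hab hba (fun T i j => hitProbAux r d T (i, j))
      (fun T i j => ⟨(bds T i j).1, (bds T i j).2.1⟩)
      (fun i j => by simp [hitProbAux]) (fun T i j => hit_rec r d T i j) n
    refine IsBigO.of_bound K ?_
    filter_upwards [eventually_ge_atTop (n + 1)] with j hj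
    have hj0 : (0:ℝ) < j := by
      have : 0 < j := by omega
      exact_mod_cast this
    have h0 : 0 ≤ extinctionProb r d n j := ge_of_tendsto' (hlim n j) fun T => (bds T n j).1
    rw [Real.norm_of_nonneg h0, Real.norm_of_nonneg (by positivity), mul_one_div]
    refine le_of_tendsto' (hlim n j) fun T => (hK T n j le_rfl (by omega)).trans ?_
    gcongr
    have : (0:ℝ) ≤ n := by positivity
    linarith
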